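/- (Invertibility of the Gabor operator on L².) Fix s ≥ 0 and let v(z) = (1+|z|)^s on ℝ^{2d}. Let γ ∈ L¹(ℝ^d), let g be measurable on ℝ^d with ĝ ∈ L¹(ℝ^d), with (γ,g)_{L²} ≠ 0, and let L be an invertible real 2d×2d matrix such that Σ_{κ∈ℤ^{2d}, κ≠0} v(𝒥L^{−T}κ) |V_gγ(𝒥L^{−T}κ)| < |(γ,g)_{L²}|. Then the Gabor operator S^L_{g,γ} (the bounded operator on L²(ℝ^d) satisfying (Su,φ)_{L²} = Σ_{κ∈ℤ^{2d}} (u,π_{−Lκ}g)_{L²}(π_{−Lκ}γ,φ)_{L²} for all u,φ ∈ L²) is invertible as a bounded operator on L²(ℝ^d), with bounded inverse satisfying ‖(S^L_{g,γ})^{−1}‖ ≤ |det L| / ( 2|(γ,g)_{L²}| − σ_{L,g,γ} ), where σ_{L,g,γ} := Σ_{κ∈ℤ^{2d}} v(𝒥L^{−T}κ) |V_gγ(𝒥L^{−T}κ)|. -/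

import Mathlib

open MeasureTheory Matrix Filter
open scoped ENNReal NNReal

noncomputable section

/-- `ℝ^d` with the Euclidean norm. -/
abbrev Euc (d : ℕ) := EuclideanSpace ℝ (Fin d)

/-- Index set for `ℝ^{2d} = ℝ^d × ℝ^d`. -/
abbrev ι2 (d : ℕ) := Sum (Fin d) (Fin d)

/-- Turn a plain vector into a point of Euclidean space. -/
def toE {d : ℕ} (x : Fin d → ℝ) : Euc d := (EuclideanSpace.equiv (Fin d) ℝ).symm x

/-- The Euclidean norm of a vector of `ℝ^{2d}`. -/
def norm2 {d : ℕ} (z : ι2 d → ℝ) : ℝ := ‖(EuclideanSpace.equiv (ι2 d) ℝ).symm z‖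

/-- `e^{2πit}`. -/
def e2 (t : ℝ) : ℂ := Complex.exp (2 * Real.pi * Complex.I * t)

/-- The dot product `x·ω = ∑ⱼ xⱼωⱼ`. -/
def dotE {d : ℕ} (x y : Euc d) : ℝ := ∑ j, x j * y j

/-- First (time) component of `z = (x,ω) ∈ ℝ^{2d}`. -/
def xpart {d : ℕ} (z : ι2 d → ℝ) : Euc d := toE fun i => z (Sum.inl i)

/-- Second (frequency) component of `z = (x,ω) ∈ ℝ^{2d}`. -/
def wpart {d : ℕ} (z : ι2 d → ℝ) : Euc d := toE fun i => z (Sum.inr i)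

/-- The symplectic matrix `𝒥` as a map: `𝒥(x,ω) = (-ω,x)`. -/
def Jmap {d : ℕ} (z : ι2 d → ℝ) : ι2 d → ℝ :=
  Sum.elim (fun i => -(z (Sum.inr i))) (fun i => z (Sum.inl i))

/-- Time-frequency shift `π_z f(t) = e^{2πi ω·t} f(t-x)` for `z = (x,ω)`. -/
def tfs {d : ℕ} (z : ι2 d → ℝ) (f : Euc d → ℂ) (t : Euc d) : ℂ :=
  e2 (dotE (wpart z) t) * f (t - xpart z)

/-- The short-time Fourier transform
`V_gγ(x,ω) = ∫ γ(t) e^{-2πi ω·t} conj(g(t-x)) dt`. -/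
def STFT {d : ℕ} (g γ : Euc d → ℂ) (x ω : Euc d) : ℂ :=
  ∫ t : Euc d, γ t * e2 (-(dotE ω t)) * (starRingEnd ℂ) (g (t - x))

/-- The vector `Lκ ∈ ℝ^{2d}` for `κ ∈ ℤ^{2d}`. -/
def latV {d : ℕ} (L : Matrix (ι2 d) (ι2 d) ℝ) (κ : ι2 d → ℤ) : ι2 d → ℝ :=
  L.mulVec fun i => (κ i : ℝ)

/-- The dual lattice vector `𝒥 L^{-T} κ ∈ ℝ^{2d}`. -/
def dualV {d : ℕ} (L : Matrix (ι2 d) (ι2 d) ℝ) (κ : ι2 d → ℤ) : ι2 d → ℝ :=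
  Jmap ((L⁻¹)ᵀ.mulVec fun i => (κ i : ℝ))

/-- The order `|κ| = ∑ᵢ |κᵢ|` of `κ ∈ ℤ^{2d}`. -/
def ordκ {d : ℕ} (κ : ι2 d → ℤ) : ℕ := ∑ i, (κ i).natAbs


section Poisson
variable {ι : Type*} [Fintype ι]

/-- Integer vector cast to the reals. -/
def castV (κ : ι → ℤ) : ι → ℝ := fun i => (κ i : ℝ)

/-- Half-open unit cubes. -/
def cubeS (κ : ι → ℤ) : Set (ι → ℝ) := {x | ∀ i, x i ∈ Set.Ioc (κ i : ℝ) (κ i + 1)}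

lemma cubeS_meas (κ : ι → ℤ) : MeasurableSet (cubeS κ) :=
  MeasurableSet.univ_pi' (fun _ => measurableSet_Ioc)

lemma mem_cubeS_iff (κ : ι → ℤ) (x : ι → ℝ) : x ∈ cubeS κ ↔ ∀ i, ⌈x i⌉ = κ i + 1 := by
  simp only [cubeS, Set.mem_ofPred_eq, Set.mem_Ioc]
  refine forall_congr' fun i => ?_
  rw [Int.ceil_eq_iff]
  push_cast
  simp

lemma cubeS_disj : Pairwise (Function.onFun Disjoint (cubeS (ι := ι))) := by
  intro a b hab
  rw [Function.onFun, Set.disjoint_left]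
  intro x hx hy
  apply hab
  rw [mem_cubeS_iff] at hx hy
  funext i
  have := hx i
  have := hy i
  omega

lemma cubeS_union : (⋃ κ, cubeS (ι := ι) κ) = Set.univ := by
  ext x
  simp only [Set.mem_iUnion, Set.mem_univ, iff_true]
  exact ⟨fun i => ⌈x i⌉ - 1, by rw [mem_cubeS_iff]; intro i; ring⟩

lemma cubeS_preimage (a κ : ι → ℤ) :
    (fun x : ι → ℝ => x + castV κ) ⁻¹' cubeS (a + κ) = cubeS a := by
  ext x
  simp only [Set.mem_preimage, mem_cubeS_iff, castV, Pi.add_apply, Int.ceil_add_intCast]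
  exact forall_congr' fun i => by omega

lemma lint_shift (f : (ι → ℝ) → ℝ≥0∞) (a κ : ι → ℤ) :
    ∫⁻ x in cubeS a, f (x + castV κ) = ∫⁻ x in cubeS (a + κ), f x := by
  rw [← cubeS_preimage a κ]
  exact (measurePreserving_add_right volume (castV κ)).setLIntegral_comp_preimage_emb
    (measurableEmbedding_addRight _) _ _

lemma int_shift (f : (ι → ℝ) → ℂ) (a κ : ι → ℤ) :
    ∫ x in cubeS a, f (x + castV κ) = ∫ x in cubeS (a + κ), f x := by
  rw [← cubeS_preimage a κ]
  exact (measurePreserving_add_right volume (castV κ)).setIntegral_preimage_emb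
    (measurableEmbedding_addRight _) _ _

lemma lint_tsum (f : (ι → ℝ) → ℂ) (hf : Integrable f) (a : ι → ℤ) :
    ∫⁻ x in cubeS a, ∑' κ, ‖f (x + castV κ)‖ₑ = ∫⁻ x, ‖f x‖ₑ := by
  rw [lintegral_tsum]
  · simp_rw [lint_shift (fun x => ‖f x‖ₑ) a]
    refine ((Equiv.addLeft a).tsum_eq (fun κ => ∫⁻ x in cubeS κ, ‖f x‖ₑ)).trans ?_
    rw [← lintegral_iUnion cubeS_meas cubeS_disj, cubeS_union, Measure.restrict_univ]
  · intro κ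
    refine AEMeasurable.restrict ?_
    exact (hf.comp_add_right (castV κ)).aestronglyMeasurable.enorm

lemma ae_summ (f : (ι → ℝ) → ℂ) (hf : Integrable f) :
    ∀ᵐ x, Summable fun κ : ι → ℤ => ‖f (x + castV κ)‖ := by
  rw [← Measure.restrict_univ (μ := (volume : Measure (ι → ℝ))), ← cubeS_union, ae_restrict_iUnion_iff]
  intro a
  have h1 : ∫⁻ x in cubeS a, ∑' κ, ‖f (x + castV κ)‖ₑ ≠ ∞ := by
    rw [lint_tsum f hf a]; exact hf.2.ne
  have h2 := ae_lt_top' (AEMeasurable.ennreal_tsum fun κ =>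
    ((hf.comp_add_right (castV κ)).aestronglyMeasurable.enorm).restrict) h1
  filter_upwards [h2] with x hx
  have := ENNReal.summable_toReal hx.ne
  simpa using this

lemma mFourier_coe (k : ι → ℤ) (x : ι → ℝ) :
    UnitAddTorus.mFourier k (fun i => (x i : UnitAddCircle))
      = e2 (∑ i, (k i : ℝ) * x i) := by
  simp only [UnitAddTorus.mFourier, ContinuousMap.coe_mk, fourier_coe_apply, e2]
  rw [← Complex.exp_sum]
  congr 1
  push_cast
  rw [Finset.mul_sum]
  refine Finset.sum_congr rfl fun i _ => ?_
  simp; ring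

lemma e2_add (s t : ℝ) : e2 (s + t) = e2 s * e2 t := by
  simp only [e2, ← Complex.exp_add]; congr 1; push_cast; ring

lemma e2_int (n : ℤ) : e2 (n : ℝ) = 1 := by
  simp only [e2]
  rw [← Complex.exp_int_mul_two_pi_mul_I n]
  congr 1; push_cast; ring

lemma norm_e2 (t : ℝ) : ‖e2 t‖ = 1 := by
  have : e2 t = Complex.exp (((2 * Real.pi * t : ℝ) : ℂ) * Complex.I) := by
    simp only [e2]; congr 1; push_cast; ring
  rw [this, Complex.norm_exp_ofReal_mul_I]

@[fun_prop]
lemma e2_cont : Continuous e2 := by unfold e2; fun_prop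

lemma poisson (f P : (ι → ℝ) → ℂ) (hf : Integrable f) (hP : Continuous P)
    (hfP : ∀ x, (Summable fun κ : ι → ℤ => f (x + castV κ)) →
      P x = ∑' κ : ι → ℤ, f (x + castV κ))
    (hs : Summable fun k : ι → ℤ => ∫ x, e2 (-(∑ i, (k i : ℝ) * x i)) * f x) :
    P 0 = ∑' k : ι → ℤ, ∫ x, e2 (-(∑ i, (k i : ℝ) * x i)) * f x := by
  have hae := ae_summ f hf
  have hper : ∀ n : ι → ℤ, ∀ x, P (x + castV n) = P x := by
    intro n
    have : (fun x => P (x + castV n)) = P := by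
      refine (Continuous.ae_eq_iff_eq volume (by fun_prop) hP).1 ?_
      filter_upwards [hae] with x hx
      have hx' := hx.of_norm
      have hcast : ∀ κ : ι → ℤ, x + castV n + castV κ = x + castV (n + κ) := by
        intro κ; funext i; simp [castV, add_assoc]
      rw [hfP x hx', hfP (x + castV n)]
      · simp_rw [hcast]
        exact (Equiv.addLeft n).tsum_eq (fun κ => f (x + castV κ))
      · simp_rw [hcast]
        exact (Equiv.addLeft n).summable_iff.2 hx'
    exact fun x => congrFun this x
  let q : (ι → ℝ) → UnitAddTorus ι := Pi.map fun _ x => (x : UnitAddCircle)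
  have hq : IsOpenQuotientMap q := IsOpenQuotientMap.piMap fun _ =>
    QuotientAddGroup.isOpenQuotientMap_mk
  have hfac : ∀ x y, q x = q y → P x = P y := by
    intro x y hxy
    have : ∀ i, ∃ n : ℤ, y i + n = x i := by
      intro i
      have h := congrFun hxy i
      have h' : ((x i : ℝ) : UnitAddCircle) = ((y i : ℝ) : UnitAddCircle) := h
      rw [QuotientAddGroup.eq_iff_sub_mem, AddSubgroup.mem_zmultiples_iff] at h'
      obtain ⟨n, hn⟩ := h'
      refine ⟨n, ?_⟩
      simp at hn
      rw [hn]; ring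
    choose n hn using this
    have : x = y + castV n := by funext i; simp [castV, hn]
    rw [this, hper]
  let Pt : C(UnitAddTorus ι, ℂ) :=
    ⟨fun z => P (Function.surjInv hq.surjective z), by
      rw [hq.isQuotientMap.continuous_iff]
      refine hP.congr fun x => ?_
      exact hfac _ _ (Function.surjInv_eq hq.surjective _).symm⟩
  have hPt : ∀ x, Pt (q x) = P x := fun x => hfac _ _ (Function.surjInv_eq hq.surjective _)
  have hcoef : ∀ k, UnitAddTorus.mFourierCoeff Pt k =
      ∫ x, e2 (-(∑ i, (k i : ℝ) * x i)) * f x := by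
    intro k
    set F : (ι → ℝ) → ℂ := fun x => e2 (-(∑ i, (k i : ℝ) * x i)) * f x with hF
    have hFn : ∀ x, ‖F x‖ = ‖f x‖ := by intro x; simp [F, norm_e2]
    have hFi : Integrable F := by
      refine (integrable_norm_iff ?_).1 ?_
      · exact (Continuous.aestronglyMeasurable (by fun_prop)).mul hf.aestronglyMeasurable
      · simp_rw [hFn]; exact hf.norm
    rw [UnitAddTorus.mFourierCoeff_eq_integral Pt k 0]
    have hset : {x : ι → ℝ | ∀ i, x i ∈ Set.Ioc ((0 : ι → ℝ) i) ((0 : ι → ℝ) i + 1)}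
        = cubeS (0 : ι → ℤ) := by
      ext x; simp [cubeS]
    rw [hset]
    have h1 : ∫ x in cubeS (0 : ι → ℤ), ∑' κ : ι → ℤ, F (x + castV κ)
        = ∫ x, F x := by
      rw [integral_tsum]
      · simp_rw [int_shift F 0]
        rw [← setIntegral_univ, ← cubeS_union,
          integral_iUnion cubeS_meas cubeS_disj hFi.integrableOn]
        simp
      · intro κ
        exact ((hFi.comp_add_right (castV κ)).aestronglyMeasurable).restrict
      · simp_rw [lint_shift (fun x => ‖F x‖ₑ) 0]
        simp only [zero_add]
        rw [← lintegral_iUnion cubeS_meas cubeS_disj, cubeS_union, Measure.restrict_univ]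
        exact hFi.2.ne
    rw [← h1]
    refine integral_congr_ae (ae_restrict_of_ae ?_)
    filter_upwards [hae] with x hx
    have hx' := hx.of_norm
    have e1 : Pt (fun i => (x i : UnitAddCircle)) = P x := hPt x
    have e2' : ∀ κ, F (x + castV κ) = e2 (-(∑ i, (k i : ℝ) * x i)) * f (x + castV κ) := by
      intro κ
      simp only [F]
      congr 1
      have : -(∑ i, (k i : ℝ) * (x + castV κ) i) = -(∑ i, (k i : ℝ) * x i)
          + ((-∑ i, k i * κ i : ℤ) : ℝ) := by
        push_cast
        simp only [castV, Pi.add_apply, mul_add, Finset.sum_add_distrib]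
        ring
      rw [this, e2_add, e2_int, mul_one]
    simp_rw [e2']
    rw [tsum_mul_left, ← hfP x hx', e1, mFourier_coe, smul_eq_mul]
    congr 2
    simp
  have hsum : Summable (UnitAddTorus.mFourierCoeff Pt) := by
    refine hs.congr fun k => (hcoef k).symm
  have := UnitAddTorus.hasSum_mFourier_series_apply_of_summable hsum (q 0)
  rw [hPt] at this
  rw [← this.tsum_eq]
  refine tsum_congr fun k => ?_
  rw [hcoef]
  have : UnitAddTorus.mFourier k (q 0) = 1 := by
    have h := mFourier_coe k (0 : ι → ℝ)
    have h0 : q 0 = fun i => (((0 : ι → ℝ) i : ℝ) : UnitAddCircle) := rfl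
    rw [h0, h]
    simp [e2]
  rw [this]; simp

end Poisson
section Analysis
open scoped FourierTransform
variable {d : ℕ}

lemma dotE_inner (x y : Euc d) : dotE x y = inner ℝ x y := by
  simp only [dotE, PiLp.inner_apply]
  refine Finset.sum_congr rfl fun i _ => ?_
  simp [mul_comm]

lemma dotE_comm (x y : Euc d) : dotE x y = dotE y x := by
  simp only [dotE, mul_comm]

lemma dotE_add_left (x y z : Euc d) : dotE (x + y) z = dotE x z + dotE y z := by
  simp only [dotE_inner, inner_add_left]

lemma dotE_add_right (x y z : Euc d) : dotE x (y + z) = dotE x y + dotE x z := by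
  simp only [dotE_inner, inner_add_right]

lemma dotE_sub_left (x y z : Euc d) : dotE (x - y) z = dotE x z - dotE y z := by
  simp only [dotE_inner, inner_sub_left]

lemma dotE_sub_right (x y z : Euc d) : dotE x (y - z) = dotE x y - dotE x z := by
  simp only [dotE_inner, inner_sub_right]

lemma dotE_neg_left (x z : Euc d) : dotE (-x) z = - dotE x z := by
  simp only [dotE_inner, inner_neg_left]

@[fun_prop]
lemma dotE_cont {X : Type*} [TopologicalSpace X] {f g : X → Euc d} (hf : Continuous f)
    (hg : Continuous g) : Continuous fun x => dotE (f x) (g x) := by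
  simp only [dotE_inner]; exact hf.inner hg

lemma conj_e2 (t : ℝ) : (starRingEnd ℂ) (e2 t) = e2 (-t) := by
  simp only [e2, ← Complex.exp_conj]
  congr 1
  simp
  left
  exact map_ofNat _ 2

lemma e2_zero : e2 0 = 1 := by simp [e2]

lemma e2_eq_char (t : ℝ) : e2 t = (Real.fourierChar t : ℂ) := by
  rw [Real.fourierChar_apply, e2]; congr 1; push_cast; ring

lemma ft_eq (f : Euc d → ℂ) (w : Euc d) : 𝓕 f w = ∫ v, e2 (-(dotE v w)) * f v := by
  rw [Real.fourier_eq]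
  simp only [Circle.smul_def, e2_eq_char, dotE_inner, smul_eq_mul]

lemma fti_eq (f : Euc d → ℂ) (w : Euc d) : 𝓕⁻ f w = ∫ v, e2 (dotE v w) * f v := by
  rw [Real.fourierInv_eq]
  simp only [Circle.smul_def, e2_eq_char, dotE_inner, smul_eq_mul]

/-- The continuous representative. -/
def gz (G : Euc d → ℂ) (x : Euc d) : ℂ := ∫ ω : Euc d, G ω * e2 (dotE x ω)

lemma gz_cont (G : Euc d → ℂ) (hG : Integrable G) : Continuous (gz G) := by
  refine continuous_of_dominated (bound := fun ω => ‖G ω‖) ?_ ?_ hG.norm ?_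
  · intro x
    exact hG.aestronglyMeasurable.mul (Continuous.aestronglyMeasurable (by fun_prop))
  · intro x; exact .of_forall fun ω => by simp [norm_e2]
  · exact .of_forall fun ω => by fun_prop

lemma gz_bound (G : Euc d → ℂ) (x : Euc d) : ‖gz G x‖ ≤ ∫ ω, ‖G ω‖ := by
  refine (norm_integral_le_integral_norm _).trans (le_of_eq ?_)
  simp [norm_e2]

def Aop (u g : Euc d → ℂ) (x ω : Euc d) : ℂ :=
  ∫ t, u t * e2 (dotE ω t) * (starRingEnd ℂ) (g (t + x))

def Bop (γ φ : Euc d → ℂ) (x ω : Euc d) : ℂ :=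
  ∫ t, e2 (-(dotE ω t)) * γ (t + x) * (starRingEnd ℂ) (φ t)

lemma A_formula (u G : Euc d → ℂ) (hu : Integrable u) (hG : Integrable G) (x ω : Euc d) :
    Aop u (gz G) x ω = ∫ η, (starRingEnd ℂ) (G η) * e2 (-(dotE x η)) * 𝓕 u (η - ω) := by
  have h1 : ∀ t, u t * e2 (dotE ω t) * (starRingEnd ℂ) (gz G (t + x))
      = ∫ η, u t * e2 (dotE ω t) * ((starRingEnd ℂ) (G η) * e2 (-(dotE (t + x) η))) := by
    intro t
    rw [gz, ← integral_conj, ← integral_const_mul]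
    simp only [map_mul, conj_e2]
  rw [Aop]
  simp_rw [h1]
  rw [integral_integral_swap]
  · refine integral_congr_ae (.of_forall fun η => ?_)
    simp only
    rw [ft_eq, ← integral_const_mul]
    refine integral_congr_ae (.of_forall fun t => ?_)
    simp only
    have : -dotE t (η - ω) = -(dotE t η) + dotE ω t := by
      rw [dotE_sub_right, dotE_comm ω t]; ring
    rw [this, dotE_add_left, neg_add, e2_add, e2_add]
    ring
  · have hGc : Integrable (fun η => (starRingEnd ℂ) (G η)) := by
      refine (integrable_norm_iff ?_).1 ?_
      · exact Complex.continuous_conj.comp_aestronglyMeasurable hG.aestronglyMeasurable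
      · simpa using hG.norm
    have := hu.mul_prod hGc
    refine this.mono ?_ (.of_forall fun p => ?_)
    · have : Function.uncurry (fun t η => u t * e2 (dotE ω t) *
          ((starRingEnd ℂ) (G η) * e2 (-(dotE (t + x) η)))) = fun p : Euc d × Euc d =>
          (u p.1 * (starRingEnd ℂ) (G p.2)) * (e2 (dotE ω p.1) * e2 (-(dotE (p.1 + x) p.2))) := by
        funext p; simp only [Function.uncurry]; ring
      rw [this]
      exact (hu.mul_prod hGc).aestronglyMeasurable.mul
        (Continuous.aestronglyMeasurable (by fun_prop))
    · simp [Function.uncurry, norm_e2]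

lemma conv_int (k1 k2 : Euc d → ℝ) (h1 : Integrable k1) (h2 : Integrable k2) :
    Integrable fun ω => ∫ η, k1 η * k2 (η - ω) := by
  have := (h1.convolution_integrand (ContinuousLinearMap.mul ℝ ℝ) h2.comp_neg).integral_prod_left
  simpa using this

lemma conj_int {f : Euc d → ℂ} (hf : Integrable f) :
    Integrable (fun x => (starRingEnd ℂ) (f x)) := by
  refine (integrable_norm_iff ?_).1 ?_
  · exact Complex.continuous_conj.comp_aestronglyMeasurable hf.aestronglyMeasurable
  · simpa using hf.norm

lemma A_cont (u g : Euc d → ℂ) (hu : Integrable u) (huc : Continuous u) (hg : Continuous g) (M : ℝ)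
    (hM : ∀ x, ‖g x‖ ≤ M) : Continuous fun p : Euc d × Euc d => Aop u g p.1 p.2 := by
  refine continuous_of_dominated (bound := fun t => ‖u t‖ * M) ?_ ?_ (hu.norm.mul_const _) ?_
  · intro p
    exact Continuous.aestronglyMeasurable (by fun_prop)
  · intro p; exact .of_forall fun t => by
      simp only [norm_mul, norm_e2, mul_one, RCLike.norm_conj]
      gcongr; exact hM _
  · exact .of_forall fun t => by fun_prop

lemma B_shift (γ φ : Euc d → ℂ) (x ω : Euc d) :
    Bop γ φ x ω = ∫ t, e2 (-(dotE ω (t - x))) * γ t * (starRingEnd ℂ) (φ (t - x)) := by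
  rw [Bop, ← integral_add_right_eq_self
    (fun t => e2 (-(dotE ω (t - x))) * γ t * (starRingEnd ℂ) (φ (t - x))) x]
  simp

lemma B_cont (γ φ : Euc d → ℂ) (hγ : Integrable γ) (hφ : Continuous φ) (M : ℝ)
    (hM : ∀ x, ‖φ x‖ ≤ M) : Continuous fun p : Euc d × Euc d => Bop γ φ p.1 p.2 := by
  have e : (fun p : Euc d × Euc d => Bop γ φ p.1 p.2) = fun p => ∫ t, e2 (-(dotE p.2 (t - p.1))) *
      γ t * (starRingEnd ℂ) (φ (t - p.1)) := funext fun p => B_shift _ _ _ _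
  rw [e]
  refine continuous_of_dominated (bound := fun t => ‖γ t‖ * M) ?_ ?_ (hγ.norm.mul_const _) ?_
  · intro p
    refine AEStronglyMeasurable.mul (AEStronglyMeasurable.mul ?_ hγ.aestronglyMeasurable) ?_
    · exact Continuous.aestronglyMeasurable (by fun_prop)
    · exact Continuous.aestronglyMeasurable (by fun_prop)
  · intro p; exact .of_forall fun t => by
      simp only [norm_mul, norm_e2, one_mul, RCLike.norm_conj]
      gcongr; exact hM _
  · exact .of_forall fun t => by fun_prop

lemma A_bound (u G : Euc d → ℂ) (hu : Integrable u) (hG : Integrable G) (x ω : Euc d) :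
    ‖Aop u (gz G) x ω‖ ≤ ∫ η, ‖G η‖ * ‖𝓕 u (η - ω)‖ := by
  rw [A_formula u G hu hG]
  refine (norm_integral_le_integral_norm _).trans (le_of_eq ?_)
  simp [norm_e2]

lemma B_bound (γ φ : Euc d → ℂ) (x ω : Euc d) :
    ‖Bop γ φ x ω‖ ≤ ∫ t, ‖γ t‖ * ‖φ (t - x)‖ := by
  rw [B_shift]
  refine (norm_integral_le_integral_norm _).trans (le_of_eq ?_)
  simp [norm_e2]

lemma F_int (u G γ φ : Euc d → ℂ) (hu : Integrable u) (huc : Continuous u) (hG : Integrable G)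
    (hU : Integrable (𝓕 u)) (hγ : Integrable γ) (hφ : Integrable φ) (hφc : Continuous φ)
    (M : ℝ) (hM : ∀ x, ‖φ x‖ ≤ M) :
    Integrable (fun p : Euc d × Euc d => Aop u (gz G) p.1 p.2 * Bop γ φ p.1 p.2)
      (volume.prod volume) := by
  have ha := conv_int _ _ hG.norm hU.norm
  have hb := conv_int _ _ hγ.norm hφ.norm
  refine (hb.mul_prod ha).mono' ?_ (.of_forall fun p => ?_)
  · exact ((A_cont u _ hu huc (gz_cont G hG) _ (gz_bound G)).mul
      (B_cont γ φ hγ hφc M hM)).aestronglyMeasurable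
  · rw [norm_mul, mul_comm]
    exact mul_le_mul (B_bound _ _ _ _) (A_bound _ _ hu hG _ _) (norm_nonneg _)
      (integral_nonneg fun t => by positivity)

lemma parseval (u G γ φ : Euc d → ℂ) (hu : Integrable u) (huc : Continuous u) (hG : Integrable G)
    (hU : Integrable (𝓕 u)) (hγ : Integrable γ) (hφc : Continuous φ)
    (M : ℝ) (hM : ∀ x, ‖φ x‖ ≤ M) (x q : Euc d) :
    ∫ ω, e2 (-(dotE ω q)) * (Aop u (gz G) x ω * Bop γ φ x ω)
      = ∫ s, γ (s - q + x) * (starRingEnd ℂ) (φ (s - q)) *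
          (u s * (starRingEnd ℂ) (gz G (s + x))) := by
  have hgc := gz_cont G hG
  set f : Euc d → ℂ := fun s => γ (s - q + x) * (starRingEnd ℂ) (φ (s - q)) with hf
  set h : Euc d → ℂ := fun s => u s * (starRingEnd ℂ) (gz G (s + x)) with hh
  have hfi : Integrable f := by
    refine Integrable.mul_bdd (c := M) ?_ ?_ ?_
    · have := hγ.comp_add_right (x - q)
      refine this.congr (.of_forall fun s => ?_)
      simp only; congr 1; abel
    · exact Continuous.aestronglyMeasurable (by fun_prop)
    · exact .of_forall fun s => by simpa using hM _
  have hhi : Integrable h := by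
    refine Integrable.mul_bdd (c := ∫ ω, ‖G ω‖) hu ?_ ?_
    · exact Continuous.aestronglyMeasurable (by fun_prop)
    · exact .of_forall fun s => by simpa using gz_bound G _
  have hhc : Continuous h := by fun_prop
  have hA : ∀ ω, 𝓕⁻ h ω = Aop u (gz G) x ω := by
    intro ω
    rw [fti_eq, Aop]
    refine integral_congr_ae (.of_forall fun t => ?_)
    simp only [h, dotE_comm ω t]; ring
  have hAi : Integrable (𝓕⁻ h) := by
    refine (conv_int _ _ hG.norm hU.norm).mono' ?_ (.of_forall fun ω => ?_)
    · have : 𝓕⁻ h = fun ω => Aop u (gz G) x ω := funext hA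
      rw [this]
      exact ((A_cont u _ hu huc hgc _ (gz_bound G)).comp
        (by fun_prop : Continuous fun ω : Euc d => (x, ω))).aestronglyMeasurable
    · rw [hA]; exact A_bound _ _ hu hG _ _
  have hFi : Integrable (𝓕 h) := by
    have := hAi.comp_neg
    refine this.congr (.of_forall fun ω => ?_)
    simp [Real.fourierInv_eq_fourier_neg]
  have hinv : 𝓕 (𝓕⁻ h) = h := hhc.fourier_fourierInv_eq hhi hFi
  have hB : ∀ ω, 𝓕 f ω = e2 (-(dotE ω q)) * Bop γ φ x ω := by
    intro ω
    rw [ft_eq, Bop, ← integral_const_mul, ← integral_add_right_eq_self _ q]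
    refine integral_congr_ae (.of_forall fun t => ?_)
    simp only [f, add_sub_cancel_right, dotE_add_left, neg_add, e2_add]
    rw [dotE_comm t ω, dotE_comm q ω]; ring
  have key : ∫ ω, 𝓕 f ω • 𝓕⁻ h ω = ∫ s, f s • 𝓕 (𝓕⁻ h) s := by
    simpa using! (VectorFourier.integral_fourierIntegral_smul_eq_flip (L := innerₗ (Euc d))
      Real.continuous_fourierChar continuous_inner hfi hAi)
  rw [hinv] at key
  rw [show (∫ s, f s * h s) = ∫ s, f s • h s from rfl, ← key]
  refine integral_congr_ae (.of_forall fun ω => ?_)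
  simp only [hA, hB, smul_eq_mul]; ring

lemma key_coef (u G γ φ : Euc d → ℂ) (hu : Integrable u) (huc : Continuous u) (hG : Integrable G)
    (hU : Integrable (𝓕 u)) (hγ : Integrable γ) (hφ : Integrable φ) (hφc : Continuous φ)
    (M : ℝ) (hM : ∀ x, ‖φ x‖ ≤ M) (N : ℝ) (hN : ∀ x, ‖u x‖ ≤ N) (p q : Euc d) :
    ∫ z : Euc d × Euc d, e2 (-(dotE p z.1 + dotE q z.2)) *
        (Aop u (gz G) z.1 z.2 * Bop γ φ z.1 z.2)
      = STFT (gz G) γ (-q) p * ∫ t, e2 (dotE p t) * u (t - (-q)) * (starRingEnd ℂ) (φ t) := by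
  have hgc := gz_cont G hG
  have hFi := F_int u G γ φ hu huc hG hU hγ hφ hφc M hM
  rw [Measure.volume_eq_prod, integral_prod]
  swap
  · refine hFi.mono ?_ (.of_forall fun z => ?_)
    · exact (Continuous.aestronglyMeasurable (by fun_prop)).mul hFi.aestronglyMeasurable
    · simp [norm_e2]
  have h1 : ∀ x, ∫ ω, e2 (-(dotE p x + dotE q ω)) * (Aop u (gz G) x ω * Bop γ φ x ω)
      = ∫ s, e2 (-(dotE p x)) * (γ (s - q + x) * (starRingEnd ℂ) (φ (s - q)) *
          (u s * (starRingEnd ℂ) (gz G (s + x)))) := by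
    intro x
    rw [integral_const_mul, ← parseval u G γ φ hu huc hG hU hγ hφc M hM x q,
      ← integral_const_mul]
    refine integral_congr_ae (.of_forall fun ω => ?_)
    simp only [neg_add, e2_add, dotE_comm ω q]; ring
  simp_rw [h1]
  rw [integral_integral_swap]
  · have h2 : ∀ s, ∫ x, e2 (-(dotE p x)) * (γ (s - q + x) * (starRingEnd ℂ) (φ (s - q)) *
          (u s * (starRingEnd ℂ) (gz G (s + x))))
        = STFT (gz G) γ (-q) p * (e2 (dotE p (s - q)) * u s * (starRingEnd ℂ) (φ (s - q))) := by
      intro s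
      symm
      rw [STFT, ← integral_mul_const, ← integral_add_left_eq_self _ (s - q)]
      refine integral_congr_ae (.of_forall fun x => ?_)
      simp only
      have e1 : s - q + x - -q = s + x := by abel
      have e3 : -(dotE p x) = -(dotE p (s - q + x)) + dotE p (s - q) := by
        rw [dotE_add_right]; ring
      rw [e1, e3, e2_add]; ring
    simp_rw [h2]
    rw [integral_const_mul]
    congr 1
    rw [← integral_add_right_eq_self _ q]
    simp
  · 
    have hM0 : 0 ≤ N := (norm_nonneg _).trans (hN 0)
    have hI0 : 0 ≤ ∫ ω, ‖G ω‖ := integral_nonneg fun _ => norm_nonneg _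
    have hpr : Integrable (fun z : Euc d × Euc d => (starRingEnd ℂ) (φ (z.2 - q)) *
        γ (z.2 - q + z.1)) (volume.prod volume) := by
      have h := (conj_int hφ).comp_neg.convolution_integrand (ContinuousLinearMap.mul ℂ ℂ) hγ
      have mp : MeasurePreserving (fun z : Euc d × Euc d => (z.1, q - z.2))
          (volume.prod volume) (volume.prod volume) :=
        (MeasurePreserving.id _).prod (Measure.measurePreserving_sub_left volume q)
      have h' := mp.integrable_comp_of_integrable h
      refine h'.congr (.of_forall fun z => ?_)
      simp only [Function.comp, ContinuousLinearMap.mul_apply']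
      congr 2 <;> abel_nf
    refine (hpr.norm.mul_const (N * ∫ ω, ‖G ω‖)).mono' ?_ (.of_forall fun z => ?_)
    · have : Function.uncurry (fun x s => e2 (-(dotE p x)) *
          (γ (s - q + x) * (starRingEnd ℂ) (φ (s - q)) *
          (u s * (starRingEnd ℂ) (gz G (s + x))))) = fun z : Euc d × Euc d =>
          ((starRingEnd ℂ) (φ (z.2 - q)) * γ (z.2 - q + z.1)) *
          (e2 (-(dotE p z.1)) * (u z.2 * (starRingEnd ℂ) (gz G (z.2 + z.1)))) := by
        funext z; simp only [Function.uncurry]; ring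
      rw [this]
      exact hpr.aestronglyMeasurable.mul (Continuous.aestronglyMeasurable (by fun_prop))
    · simp only [Function.uncurry, norm_mul, norm_e2, one_mul, RCLike.norm_conj]
      rw [mul_comm ‖γ _‖]
      gcongr
      · exact hN _
      · exact gz_bound G _

end Analysis
section Assembly
open scoped FourierTransform SchwartzMap
variable {d : ℕ}

lemma xpart_add (z w : ι2 d → ℝ) : xpart (z + w) = xpart z + xpart w := by
  ext i; simp [xpart, toE]

lemma wpart_add (z w : ι2 d → ℝ) : wpart (z + w) = wpart z + wpart w := by
  ext i; simp [wpart, toE]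

lemma xpart_neg (z : ι2 d → ℝ) : xpart (-z) = -xpart z := by
  ext i; simp [xpart, toE]

lemma wpart_neg (z : ι2 d → ℝ) : wpart (-z) = -wpart z := by
  ext i; simp [wpart, toE]

@[fun_prop]
lemma xpart_cont : Continuous (xpart (d := d)) := by
  unfold xpart toE; fun_prop

@[fun_prop]
lemma wpart_cont : Continuous (wpart (d := d)) := by
  unfold wpart toE; fun_prop

lemma phi_mp : MeasurePreserving (fun z : ι2 d → ℝ => (xpart z, wpart z))
    volume (volume : Measure (Euc d × Euc d)) := by
  have h1 := volume_measurePreserving_sumPiEquivProdPi (fun _ : ι2 d => ℝ)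
  have h2 := (PiLp.volume_preserving_toLp (Fin d)).prod (PiLp.volume_preserving_toLp (Fin d))
  exact h2.comp h1

lemma phi_emb : MeasurableEmbedding (fun z : ι2 d → ℝ => (xpart z, wpart z)) := by
  refine Continuous.measurableEmbedding (by fun_prop) ?_
  intro z w h
  simp only [Prod.mk.injEq] at h
  funext i
  rcases i with i | i
  · have := congrArg (fun v : Euc d => v i) h.1
    simpa [xpart, toE] using this
  · have := congrArg (fun v : Euc d => v i) h.2
    simpa [wpart, toE] using this

lemma sum_dot (a z : ι2 d → ℝ) : ∑ i, a i * z i = dotE (xpart a) (xpart z)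
    + dotE (wpart a) (wpart z) := by
  rw [Fintype.sum_sum_type]; simp [dotE, xpart, wpart, toE]

lemma mat_emb (L : Matrix (ι2 d) (ι2 d) ℝ) (hL : IsUnit L.det) :
    MeasurableEmbedding (fun x : ι2 d → ℝ => L.mulVec x) := by
  refine Continuous.measurableEmbedding (by fun_prop) ?_
  exact Matrix.mulVec_injective_of_isUnit ((Matrix.isUnit_iff_isUnit_det _).2 hL)

lemma mat_map (L : Matrix (ι2 d) (ι2 d) ℝ) (hL : IsUnit L.det) :
    Measure.map (fun x : ι2 d → ℝ => L.mulVec x) volume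
      = ENNReal.ofReal (|L.det|⁻¹) • volume := by
  have := Real.map_matrix_volume_pi_eq_smul_volume_pi hL.ne_zero
  rw [abs_inv] at this
  exact this

lemma mat_integral (L : Matrix (ι2 d) (ι2 d) ℝ) (hL : IsUnit L.det) (h : (ι2 d → ℝ) → ℂ) :
    ∫ x, h (L.mulVec x) = ((|L.det|⁻¹ : ℝ) : ℂ) * ∫ z, h z := by
  rw [← (mat_emb L hL).integral_map, mat_map L hL, integral_smul_measure,
    ENNReal.toReal_ofReal (by positivity)]
  simp

lemma mat_integrable (L : Matrix (ι2 d) (ι2 d) ℝ) (hL : IsUnit L.det) (h : (ι2 d → ℝ) → ℂ)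
    (hh : Integrable h) : Integrable fun x => h (L.mulVec x) := by
  have : Integrable h (Measure.map (fun x : ι2 d → ℝ => L.mulVec x) volume) := by
    rw [mat_map L hL]
    exact hh.smul_measure ENNReal.ofReal_ne_top
  exact (mat_emb L hL).integrable_map_iff.1 this

lemma dot_inv (L : Matrix (ι2 d) (ι2 d) ℝ) (hL : IsUnit L.det) (k x : ι2 d → ℝ) :
    ∑ i, k i * x i = ∑ i, ((L⁻¹)ᵀ.mulVec k) i * (L.mulVec x) i := by
  change k ⬝ᵥ x = ((L⁻¹)ᵀ.mulVec k) ⬝ᵥ (L.mulVec x)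
  rw [Matrix.mulVec_transpose, ← Matrix.dotProduct_mulVec, Matrix.mulVec_mulVec,
    Matrix.nonsing_inv_mul _ hL, Matrix.one_mulVec]

lemma xpart_J (z : ι2 d → ℝ) : xpart (Jmap z) = -wpart z := by
  ext i; simp [xpart, wpart, Jmap, toE]

lemma wpart_J (z : ι2 d → ℝ) : wpart (Jmap z) = xpart z := by
  ext i; simp [xpart, wpart, Jmap, toE]

lemma tfs_norm (z : ι2 d → ℝ) (f : Euc d → ℂ) (t : Euc d) :
    ‖tfs z f t‖ = ‖f (t - xpart z)‖ := by simp [tfs, norm_e2]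

lemma tfs_cont (z : ι2 d → ℝ) (f : Euc d → ℂ) (hf : Continuous f) : Continuous (tfs z f) := by
  unfold tfs; fun_prop

lemma tfs_eLpNorm (z : ι2 d → ℝ) (f : Euc d → ℂ) (hf : Continuous f) :
    eLpNorm (tfs z f) 2 volume = eLpNorm f 2 volume := by
  have h1 : eLpNorm (tfs z f) 2 volume = eLpNorm (fun t => f (t - xpart z)) 2 volume :=
    eLpNorm_congr_norm_ae (.of_forall fun t => tfs_norm z f t)
  rw [h1]
  exact eLpNorm_comp_measurePreserving hf.aestronglyMeasurable
    (measurePreserving_sub_right volume (xpart z))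

lemma tfs_memLp (z : ι2 d → ℝ) (u : 𝓢(Euc d, ℂ)) : MemLp (tfs z u) 2 volume :=
  ⟨(tfs_cont z u u.continuous).aestronglyMeasurable, by
    have h : MemLp (u : Euc d → ℂ) 2 volume := u.memLp 2 volume
    rw [tfs_eLpNorm z u u.continuous]
    exact h.2⟩

lemma tfs_int (z : ι2 d → ℝ) (u : 𝓢(Euc d, ℂ)) : Integrable (tfs z u) := by
  refine (integrable_norm_iff (tfs_cont z u u.continuous).aestronglyMeasurable).1 ?_
  simp_rw [tfs_norm]
  exact (u.integrable.comp_sub_right (xpart z)).norm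

/-- time-frequency shift of a Schwartz function as an element of `L²` -/
def tLp (z : ι2 d → ℝ) (u : 𝓢(Euc d, ℂ)) : Lp ℂ 2 (volume : Measure (Euc d)) :=
  (tfs_memLp z u).toLp

lemma tLp_coe (z : ι2 d → ℝ) (u : 𝓢(Euc d, ℂ)) : tLp z u =ᵐ[volume] tfs z u :=
  (tfs_memLp z u).coeFn_toLp

lemma tLp_norm (z : ι2 d → ℝ) (u : 𝓢(Euc d, ℂ)) : ‖tLp z u‖ = ‖u.toLp 2 volume‖ := by
  rw [tLp, Lp.norm_toLp, tfs_eLpNorm z u u.continuous, SchwartzMap.norm_toLp]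

lemma tfs_zero (f : Euc d → ℂ) : tfs 0 f = f := by
  funext t
  have h1 : xpart (0 : ι2 d → ℝ) = 0 := by ext i; simp [xpart, toE]
  have h2 : wpart (0 : ι2 d → ℝ) = 0 := by ext i; simp [wpart, toE]
  simp [tfs, h1, h2, dotE, e2_zero]

lemma tLp_zero (u : 𝓢(Euc d, ℂ)) : tLp 0 u = u.toLp 2 volume := by
  apply Lp.ext
  filter_upwards [tLp_coe 0 u, u.coeFn_toLp 2] with t h1 h2
  rw [h1, h2, tfs_zero]

lemma int_inner (f g : Lp ℂ 2 (volume : Measure (Euc d))) :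
    ∫ t, f t * (starRingEnd ℂ) (g t) = inner ℂ g f := by
  rw [L2.inner_def]; rfl

lemma inner_tLp (z w : ι2 d → ℝ) (u v : 𝓢(Euc d, ℂ)) :
    inner ℂ (tLp w v) (tLp z u) = ∫ t, tfs z u t * (starRingEnd ℂ) (tfs w v t) := by
  rw [← int_inner]
  refine integral_congr_ae ?_
  filter_upwards [tLp_coe z u, tLp_coe w v] with t h1 h2
  rw [h1, h2]

lemma schwartz_bdd (u : 𝓢(Euc d, ℂ)) : ∃ C, ∀ x, ‖u x‖ ≤ C :=
  ⟨_, fun x => u.norm_le_seminorm ℝ x⟩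

lemma tLp_cont (u : 𝓢(Euc d, ℂ)) : Continuous fun z => tLp z u := by
  rw [continuous_iff_continuousAt]
  intro w
  obtain ⟨C, hC⟩ := schwartz_bdd u
  have hc : Continuous fun z => (inner ℂ (tLp w u) (tLp z u) : ℂ) := by
    simp_rw [inner_tLp]
    have huc := u.continuous
    refine continuous_of_dominated (bound := fun t => C * ‖tfs w u t‖) ?_ ?_
      ((tfs_int w u).norm.const_mul _) ?_
    · intro z
      have := tfs_cont z u huc
      have := tfs_cont w u huc
      exact Continuous.aestronglyMeasurable (by fun_prop)
    · intro z
      refine .of_forall fun t => ?_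
      rw [norm_mul, RCLike.norm_conj, tfs_norm]
      gcongr
      exact hC _
    · refine .of_forall fun t => ?_
      unfold tfs
      fun_prop
  have h2 : Tendsto (fun z => ‖tLp z u - tLp w u‖ ^ 2) (nhds w) (nhds 0) := by
    have e : ∀ z, ‖tLp z u - tLp w u‖ ^ 2 = 2 * ‖u.toLp 2 volume‖ ^ 2
        - 2 * RCLike.re (inner ℂ (tLp w u) (tLp z u) : ℂ) := by
      intro z
      rw [@norm_sub_sq ℂ, tLp_norm, tLp_norm, ← inner_re_symm]
      ring
    simp_rw [e]
    have hc' : Continuous fun z => 2 * ‖u.toLp 2 volume‖ ^ 2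
        - 2 * RCLike.re (inner ℂ (tLp w u) (tLp z u) : ℂ) := by fun_prop
    have := hc'.tendsto w
    rw [inner_self_eq_norm_sq, tLp_norm] at this
    simpa using this
  rw [ContinuousAt, tendsto_iff_norm_sub_tendsto_zero]
  have := h2.sqrt
  simpa [Real.sqrt_sq] using this

lemma shiftA (u : 𝓢(Euc d, ℂ)) (g : Euc d → ℂ) (g0 : Euc d → ℂ) (hg : g =ᵐ[volume] g0)
    (z w : ι2 d → ℝ) :
    ∫ t, tLp w u t * (starRingEnd ℂ) (tfs (-z) g t)
      = e2 (dotE (wpart (z + w)) (xpart w)) * Aop u g0 (xpart (z + w)) (wpart (z + w)) := by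
  have hg' : ∀ᵐ t, g (t - xpart (-z)) = g0 (t - xpart (-z)) :=
    (measurePreserving_sub_right volume (xpart (-z))).quasiMeasurePreserving.ae hg
  have : ∫ t, tLp w u t * (starRingEnd ℂ) (tfs (-z) g t)
      = ∫ t, tfs w u t * (starRingEnd ℂ) (tfs (-z) g0 t) := by
    refine integral_congr_ae ?_
    filter_upwards [tLp_coe w u, hg'] with t h1 h2
    rw [h1, tfs, tfs, h2]; rfl
  rw [this, ← integral_add_right_eq_self _ (xpart w), Aop, ← integral_const_mul]
  refine integral_congr_ae (.of_forall fun t => ?_)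
  simp only [tfs, map_mul, conj_e2, wpart_neg, xpart_neg, add_sub_cancel_right, sub_neg_eq_add]
  rw [xpart_add, wpart_add, show t + xpart w + xpart z = t + (xpart z + xpart w) by abel]
  simp only [dotE_add_left, dotE_add_right, dotE_neg_left, neg_neg, e2_add, neg_add]
  ring

lemma shiftB (φ : 𝓢(Euc d, ℂ)) (γ : Euc d → ℂ) (z w : ι2 d → ℝ) :
    ∫ t, tfs (-z) γ t * (starRingEnd ℂ) (tLp w φ t)
      = e2 (-(dotE (wpart (z + w)) (xpart w))) * Bop γ φ (xpart (z + w)) (wpart (z + w)) := by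
  have : ∫ t, tfs (-z) γ t * (starRingEnd ℂ) (tLp w φ t)
      = ∫ t, tfs (-z) γ t * (starRingEnd ℂ) (tfs w φ t) := by
    refine integral_congr_ae ?_
    filter_upwards [tLp_coe w φ] with t h1
    rw [h1]
  rw [this, ← integral_add_right_eq_self _ (xpart w), Bop, ← integral_const_mul]
  refine integral_congr_ae (.of_forall fun t => ?_)
  simp only [tfs, map_mul, conj_e2, wpart_neg, xpart_neg, add_sub_cancel_right, sub_neg_eq_add]
  rw [xpart_add, wpart_add, show t + xpart w + xpart z = t + (xpart z + xpart w) by abel]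
  simp only [dotE_add_left, dotE_add_right, dotE_neg_left, e2_add, neg_add]
  ring

lemma shiftF (u φ : 𝓢(Euc d, ℂ)) (g g0 γ : Euc d → ℂ) (hg : g =ᵐ[volume] g0)
    (z w : ι2 d → ℝ) :
    (∫ t, tLp w u t * (starRingEnd ℂ) (tfs (-z) g t)) *
      (∫ t, tfs (-z) γ t * (starRingEnd ℂ) (tLp w φ t))
      = Aop u g0 (xpart (z + w)) (wpart (z + w)) * Bop γ φ (xpart (z + w)) (wpart (z + w)) := by
  rw [shiftA u g g0 hg, shiftB]
  have : e2 (dotE (wpart (z + w)) (xpart w)) * e2 (-(dotE (wpart (z + w)) (xpart w))) = 1 := by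
    rw [← e2_add]; simp [e2_zero]
  linear_combination (Aop u g0 (xpart (z + w)) (wpart (z + w)) *
    Bop γ φ (xpart (z + w)) (wpart (z + w))) * this

lemma STFT_congr (g g0 γ : Euc d → ℂ) (hg : g =ᵐ[volume] g0) (x ω : Euc d) :
    STFT g γ x ω = STFT g0 γ x ω := by
  have hg' : ∀ᵐ t, g (t - x) = g0 (t - x) :=
    (measurePreserving_sub_right volume x).quasiMeasurePreserving.ae hg
  refine integral_congr_ae ?_
  filter_upwards [hg'] with t h
  rw [h]

lemma tendsto_ord (f : (ι2 d → ℤ) → ℂ) (hf : Summable f) :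
    Tendsto (fun h : ℕ => ∑' κ : {κ : ι2 d → ℤ // ordκ κ ≤ h}, f κ.1) atTop (nhds (∑' κ, f κ)) := by
  have e : ∀ h : ℕ, ∑' κ : {κ : ι2 d → ℤ // ordκ κ ≤ h}, f κ.1
      = ∑' κ, Set.indicator {κ : ι2 d → ℤ | ordκ κ ≤ h} f κ := fun h => tsum_subtype _ f
  simp_rw [e]
  refine tendsto_tsum_of_dominated_convergence (bound := fun κ => ‖f κ‖) hf.norm ?_ ?_
  · intro κ
    refine tendsto_const_nhds.congr' ?_
    filter_upwards [eventually_ge_atTop (ordκ κ)] with h hh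
    exact (Set.indicator_of_mem (s := {κ : ι2 d → ℤ | ordκ κ ≤ h}) hh f).symm
  · exact .of_forall fun h κ => norm_indicator_le_norm_self _ _

/-- Janssen representation, on Schwartz functions. -/
lemma janssen (γ g G : Euc d → ℂ) (hγ : Integrable γ) (hG : Integrable G)
    (hg : g =ᵐ[volume] gz G)
    (L : Matrix (ι2 d) (ι2 d) ℝ) (hL : IsUnit L.det)
    (hσ : Summable fun κ : ι2 d → ℤ => ‖STFT g γ (xpart (dualV L κ)) (wpart (dualV L κ))‖)
    (S : Lp ℂ 2 (volume : Measure (Euc d)) →L[ℂ] Lp ℂ 2 (volume : Measure (Euc d)))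
    (hS : ∀ u φ : Lp ℂ 2 (volume : Measure (Euc d)),
        Tendsto
          (fun h : ℕ => ∑' κ : {κ : ι2 d → ℤ // ordκ κ ≤ h},
            (∫ t : Euc d, u t * (starRingEnd ℂ) (tfs (-(latV L κ.1)) g t)) *
              ∫ t : Euc d, tfs (-(latV L κ.1)) γ t * (starRingEnd ℂ) (φ t))
          atTop (nhds (∫ t : Euc d, (S u) t * (starRingEnd ℂ) (φ t))))
    (u φ : 𝓢(Euc d, ℂ)) :
    HasSum (fun k => STFT g γ (xpart (dualV L k)) (wpart (dualV L k)) *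
        (inner ℂ (φ.toLp 2 volume) (tLp (dualV L k) u) : ℂ))
      (((|L.det| : ℝ) : ℂ) * inner ℂ (φ.toLp 2 volume) (S (u.toLp 2 volume))) := by
  obtain ⟨M, hM⟩ := schwartz_bdd φ
  obtain ⟨N, hN⟩ := schwartz_bdd u
  have hU : Integrable (𝓕 (u : Euc d → ℂ)) := by
    have := (𝓕 u).integrable (μ := volume)
    rwa [SchwartzMap.fourier_coe] at this
  set Fp : Euc d × Euc d → ℂ := fun p => Aop u (gz G) p.1 p.2 * Bop γ φ p.1 p.2 with hFp
  have hFi : Integrable Fp (volume.prod volume) :=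
    F_int u G γ φ u.integrable u.continuous hG hU hγ φ.integrable φ.continuous M hM
  have hFz : Integrable (fun z : ι2 d → ℝ => Fp (xpart z, wpart z)) :=
    phi_mp.integrable_comp_of_integrable hFi
  set f : (ι2 d → ℝ) → ℂ := fun x => Fp (xpart (L.mulVec x), wpart (L.mulVec x)) with hf
  have hfi : Integrable f := mat_integrable L hL _ hFz
  set P : (ι2 d → ℝ) → ℂ := fun x => inner ℂ (tLp (L.mulVec x) φ) (S (tLp (L.mulVec x) u)) with hPdef
  have hPc : Continuous P := by
    have h1 : Continuous fun x : ι2 d → ℝ => tLp (L.mulVec x) φ :=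
      (tLp_cont φ).comp (by fun_prop)
    have h2 : Continuous fun x : ι2 d → ℝ => tLp (L.mulVec x) u :=
      (tLp_cont u).comp (by fun_prop)
    exact h1.inner (S.continuous.comp h2)
  have hcoef : ∀ k : ι2 d → ℤ, ∫ x, e2 (-(∑ i, (k i : ℝ) * x i)) * f x
      = ((|L.det|⁻¹ : ℝ) : ℂ) * (STFT g γ (xpart (dualV L k)) (wpart (dualV L k)) *
        (inner ℂ (φ.toLp 2 volume) (tLp (dualV L k) u) : ℂ)) := by
    intro k
    set a : ι2 d → ℝ := (L⁻¹)ᵀ.mulVec fun i => (k i : ℝ) with ha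
    have hd : dualV L k = Jmap a := rfl
    simp_rw [dot_inv L hL (fun i => (k i : ℝ)), ← ha, sum_dot]
    rw [mat_integral L hL (fun z => e2 (-(dotE (xpart a) (xpart z) + dotE (wpart a) (wpart z))) *
      Fp (xpart z, wpart z))]
    congr 1
    rw [phi_mp.integral_comp phi_emb (fun p : Euc d × Euc d =>
      e2 (-(dotE (xpart a) p.1 + dotE (wpart a) p.2)) * Fp p)]
    rw [key_coef u G γ φ u.integrable u.continuous hG hU hγ φ.integrable φ.continuous M hM N hN,
      hd, STFT_congr g (gz G) γ hg, xpart_J, wpart_J, ← tLp_zero φ, inner_tLp, tfs_zero]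
    congr 1
  have hsum : Summable fun k => STFT g γ (xpart (dualV L k)) (wpart (dualV L k)) *
        (inner ℂ (φ.toLp 2 volume) (tLp (dualV L k) u) : ℂ) := by
    refine Summable.of_norm_bounded (hσ.mul_right (‖φ.toLp 2 volume‖ * ‖u.toLp 2 volume‖)) ?_
    intro k
    rw [norm_mul]
    gcongr
    rw [← tLp_norm (dualV L k) u]
    exact norm_inner_le_norm _ _
  have hp := poisson f P hfi hPc ?_ ?_
  · simp_rw [hcoef] at hp
    rw [tsum_mul_left] at hp
    have hP0 : P 0 = inner ℂ (φ.toLp 2 volume) (S (u.toLp 2 volume)) := by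
      simp only [P, Matrix.mulVec_zero, tLp_zero]
    rw [hP0] at hp
    rw [hp, ← mul_assoc]
    have hne : ((|L.det| : ℝ) : ℂ) ≠ 0 := by
      simpa using hL.ne_zero
    have : ((|L.det| : ℝ) : ℂ) * ((|L.det|⁻¹ : ℝ) : ℂ) = 1 := by
      push_cast
      exact mul_inv_cancel₀ hne
    rw [this, one_mul]
    exact hsum.hasSum
  · intro x hx
    have h1 := hS (tLp (L.mulVec x) u) (tLp (L.mulVec x) φ)
    rw [int_inner] at h1
    refine tendsto_nhds_unique h1 ?_
    have h2 := tendsto_ord _ hx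
    refine h2.congr fun h => tsum_congr fun κ => ?_
    rw [shiftF u φ g (gz G) γ hg]
    simp only [f, Fp]
    have : L.mulVec (x + castV κ.1) = latV L κ.1 + L.mulVec x := by
      rw [Matrix.mulVec_add, add_comm]; rfl
    rw [this]
  · simp_rw [hcoef]
    exact hsum.mul_left _

lemma invert {H : Type*} [NormedAddCommGroup H] [NormedSpace ℂ H] [CompleteSpace H]
    (S R : H →L[ℂ] H) (c : ℂ) (D σ : ℝ) (hD : 0 < D) (hσ : σ < ‖c‖) (hR : ‖R‖ ≤ σ)
    (hS : (D : ℂ) • S = c • (1 : H →L[ℂ] H) + R) :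
    ∃ T : H →L[ℂ] H, S.comp T = ContinuousLinearMap.id ℂ _
        ∧ T.comp S = ContinuousLinearMap.id ℂ _ ∧ ‖T‖ ≤ D / (‖c‖ - σ) := by
  have hc : 0 < ‖c‖ := ((norm_nonneg R).trans hR).trans_lt hσ
  have hc0 : c ≠ 0 := norm_pos_iff.1 hc
  have hD0 : (D : ℂ) ≠ 0 := by exact_mod_cast hD.ne'
  have hX : ‖-(c⁻¹ • R)‖ < 1 := by
    rw [norm_neg, norm_smul, norm_inv, inv_mul_lt_iff₀ hc]
    linarith
  let U := Units.oneSub (-(c⁻¹ • R)) hX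
  have hU : (U : H →L[ℂ] H) = ((D : ℂ) / c) • S := by
    have : (U : H →L[ℂ] H) = 1 - -(c⁻¹ • R) := rfl
    rw [this, div_eq_inv_mul, mul_smul, hS, smul_add, smul_smul, inv_mul_cancel₀ hc0]
    simp
  have e1 : S * (((D : ℂ) / c) • (↑U⁻¹ : H →L[ℂ] H)) = 1 := by
    rw [mul_smul_comm, ← smul_mul_assoc, ← hU, Units.mul_inv]
  have e3 : (((D : ℂ) / c) • (↑U⁻¹ : H →L[ℂ] H)) * S = 1 := by
    rw [smul_mul_assoc, ← mul_smul_comm, ← hU, Units.inv_mul]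
  refine ⟨((D : ℂ) / c) • (↑U⁻¹ : H →L[ℂ] H), e1, e3, ?_⟩
  set T := ((D : ℂ) / c) • (↑U⁻¹ : H →L[ℂ] H) with hT
  have h1 : c • T = (D : ℂ) • (1 : H →L[ℂ] H) - R * T := by
    have : (D : ℂ) • (S * T) = c • T + R * T := by
      rw [← smul_mul_assoc, hS, add_mul, smul_mul_assoc, one_mul]
    rw [e1] at this
    rw [this]; simp
  have h2 : ‖c‖ * ‖T‖ ≤ D + σ * ‖T‖ := by
    rw [← norm_smul, h1]
    refine (norm_sub_le _ _).trans (add_le_add ?_ ?_)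
    · rw [norm_smul]
      have : ‖(1 : H →L[ℂ] H)‖ ≤ 1 := ContinuousLinearMap.norm_id_le
      have hDn : ‖(D : ℂ)‖ = D := by simp [abs_of_pos hD]
      rw [hDn]; nlinarith
    · exact (norm_mul_le _ _).trans (mul_le_mul_of_nonneg_right hR (norm_nonneg _))
  rw [le_div_iff₀ (by linarith)]
  linarith

lemma hasSum_split {α : Type*} [NormedAddCommGroup α] (F : (ι2 d → ℤ) → α) (a : α)
    (h : HasSum (fun κ : {κ : ι2 d → ℤ // κ ≠ 0} => F κ.1) a) : HasSum F (F 0 + a) := by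
  have h1 : HasSum (Set.indicator {κ : ι2 d → ℤ | κ ≠ 0} F) a :=
    (hasSum_subtype_iff_indicator (s := {κ : ι2 d → ℤ | κ ≠ 0})).1 h
  have h2 := (hasSum_ite_eq (0 : ι2 d → ℤ) (F 0)).add h1
  convert h2 using 1
  funext κ
  by_cases hk : κ = 0
  · subst hk; simp
  · simp [hk]

end Assembly

/-- invertibility of the Gabor operator on `L²`: if `(γ,g)_{L²} ≠ 0` and
`∑_{κ≠0} v(𝒥L^{-T}κ)|V_gγ(𝒥L^{-T}κ)| < |(γ,g)_{L²}|` (with `v(z) = (1+|z|)^s`), then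
the Gabor operator `S^L_{g,γ}` — the bounded operator on `L²(ℝ^d)` with
`(Su,φ)_{L²} = ∑_κ (u,π_{-Lκ}g)_{L²}(π_{-Lκ}γ,φ)_{L²}` — is invertible with bounded
inverse satisfying `‖S⁻¹‖ ≤ |det L| / (2|(γ,g)_{L²}| - σ_{L,g,γ})`. -/
theorem stmt11 {d : ℕ} (s : ℝ) (hs : 0 ≤ s) (γ g G : Euc d → ℂ)
    (hγ : Integrable γ) (hG : Integrable G)
    (hg_meas : AEStronglyMeasurable g volume)
    (hginv : ∀ᵐ x : Euc d, g x = ∫ ω : Euc d, G ω * e2 (dotE x ω))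
    (hpair : (∫ t : Euc d, γ t * (starRingEnd ℂ) (g t)) ≠ 0)
    (L : Matrix (ι2 d) (ι2 d) ℝ) (hL : IsUnit L.det)
    (hσ : Summable fun κ : {κ : ι2 d → ℤ // κ ≠ 0} =>
      (1 + norm2 (dualV L κ.1)) ^ s
        * ‖STFT g γ (xpart (dualV L κ.1)) (wpart (dualV L κ.1))‖)
    (hlt : (∑' κ : {κ : ι2 d → ℤ // κ ≠ 0},
        (1 + norm2 (dualV L κ.1)) ^ s
          * ‖STFT g γ (xpart (dualV L κ.1)) (wpart (dualV L κ.1))‖)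
      < ‖∫ t : Euc d, γ t * (starRingEnd ℂ) (g t)‖) :
    ∀ S : Lp ℂ 2 (volume : Measure (Euc d)) →L[ℂ] Lp ℂ 2 (volume : Measure (Euc d)),
      (∀ u φ : Lp ℂ 2 (volume : Measure (Euc d)),
        Tendsto
          (fun h : ℕ => ∑' κ : {κ : ι2 d → ℤ // ordκ κ ≤ h},
            (∫ t : Euc d, u t * (starRingEnd ℂ) (tfs (-(latV L κ.1)) g t)) *
              ∫ t : Euc d, tfs (-(latV L κ.1)) γ t * (starRingEnd ℂ) (φ t))
          atTop (nhds (∫ t : Euc d, (S u) t * (starRingEnd ℂ) (φ t)))) →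
      ∃ T : Lp ℂ 2 (volume : Measure (Euc d)) →L[ℂ] Lp ℂ 2 (volume : Measure (Euc d)),
        S.comp T = ContinuousLinearMap.id ℂ _
        ∧ T.comp S = ContinuousLinearMap.id ℂ _
        ∧ ‖T‖ ≤ |L.det| /
            (2 * ‖∫ t : Euc d, γ t * (starRingEnd ℂ) (g t)‖
              - ∑' κ : ι2 d → ℤ,
                  (1 + norm2 (dualV L κ)) ^ s
                    * ‖STFT g γ (xpart (dualV L κ)) (wpart (dualV L κ))‖) := by
  classical
  intro S hS
  have hg : g =ᵐ[volume] gz G := hginv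
  set c : (ι2 d → ℤ) → ℂ := fun κ => STFT g γ (xpart (dualV L κ)) (wpart (dualV L κ)) with hc
  set v : (ι2 d → ℤ) → ℝ := fun κ => (1 + norm2 (dualV L κ)) ^ s with hv
  have hd0 : dualV L (0 : ι2 d → ℤ) = 0 := by
    have h0 : (fun i : ι2 d => (((0 : ι2 d → ℤ) i : ℤ) : ℝ)) = 0 := by
      funext i; simp
    have h1 : dualV L (0 : ι2 d → ℤ) = Jmap ((L⁻¹)ᵀ.mulVec fun i => (((0 : ι2 d → ℤ) i : ℤ) : ℝ)) :=
      rfl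
    rw [h1, h0, Matrix.mulVec_zero]
    funext i
    rcases i with i | i <;> simp [Jmap]
  have hv1 : ∀ κ, 1 ≤ v κ := fun κ =>
    Real.one_le_rpow (by have : 0 ≤ norm2 (dualV L κ) := norm_nonneg _
                         linarith) hs
  have hv0 : v 0 = 1 := by
    simp only [v, hd0]
    have : norm2 (0 : ι2 d → ℝ) = 0 := by simp [norm2]
    rw [this, add_zero, Real.one_rpow]
  have hx0 : xpart (0 : ι2 d → ℝ) = 0 := by ext i; simp [xpart, toE]
  have hw0 : wpart (0 : ι2 d → ℝ) = 0 := by ext i; simp [wpart, toE]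
  have hc0 : c 0 = ∫ t : Euc d, γ t * (starRingEnd ℂ) (g t) := by
    simp only [c, hd0, hx0, hw0, STFT]
    simp [dotE, e2_zero]
  change Summable (fun κ : {κ : ι2 d → ℤ // κ ≠ 0} => v κ.1 * ‖c κ.1‖) at hσ
  change (∑' κ : {κ : ι2 d → ℤ // κ ≠ 0}, v κ.1 * ‖c κ.1‖) < _ at hlt
  change ∃ T : Lp ℂ 2 (volume : Measure (Euc d)) →L[ℂ] Lp ℂ 2 (volume : Measure (Euc d)),
        S.comp T = ContinuousLinearMap.id ℂ _
        ∧ T.comp S = ContinuousLinearMap.id ℂ _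
        ∧ ‖T‖ ≤ |L.det| / (2 * ‖∫ t : Euc d, γ t * (starRingEnd ℂ) (g t)‖
              - ∑' κ : ι2 d → ℤ, v κ * ‖c κ‖)
  rw [← hc0] at hlt ⊢
  set σ : ℝ := ∑' κ : {κ : ι2 d → ℤ // κ ≠ 0}, v κ.1 * ‖c κ.1‖ with hσdef
  have htot : ∑' κ : ι2 d → ℤ, v κ * ‖c κ‖ = ‖c 0‖ + σ := by
    have := (hasSum_split (fun κ => v κ * ‖c κ‖) σ hσ.hasSum).tsum_eq
    rw [this, hv0, one_mul]
  have hle : ∀ κ, ‖c κ‖ ≤ v κ * ‖c κ‖ := fun κ =>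
    le_mul_of_one_le_left (norm_nonneg _) (hv1 κ)
  have hs1 : Summable fun κ : {κ : ι2 d → ℤ // κ ≠ 0} => ‖c κ.1‖ :=
    Summable.of_nonneg_of_le (fun _ => norm_nonneg _) (fun κ => hle κ.1) hσ
  have hs1le : ∑' κ : {κ : ι2 d → ℤ // κ ≠ 0}, ‖c κ.1‖ ≤ σ :=
    hs1.tsum_le_tsum (fun κ => hle κ.1) hσ
  have hs2 : Summable fun κ => ‖c κ‖ := (hasSum_split (fun κ => ‖c κ‖) _ hs1.hasSum).summable
  have hJ := janssen γ g G hγ hG hg L hL hs2 S hS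
  set R : Lp ℂ 2 (volume : Measure (Euc d)) →L[ℂ] Lp ℂ 2 (volume : Measure (Euc d)) :=
    ((|L.det| : ℝ) : ℂ) • S - c 0 • 1 with hR
  have hRS : ∀ u φ : SchwartzMap (Euc d) ℂ,
      ‖(inner ℂ (φ.toLp 2 volume) (R (u.toLp 2 volume)) : ℂ)‖
        ≤ σ * (‖φ.toLp 2 volume‖ * ‖u.toLp 2 volume‖) := by
    intro u φ
    have hb : ∀ κ : ι2 d → ℤ, ‖c κ * (inner ℂ (φ.toLp 2 volume) (tLp (dualV L κ) u) : ℂ)‖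
        ≤ ‖c κ‖ * (‖φ.toLp 2 volume‖ * ‖u.toLp 2 volume‖) := by
      intro κ
      rw [norm_mul, ← tLp_norm (dualV L κ) u]
      exact mul_le_mul_of_nonneg_left (norm_inner_le_norm _ _) (norm_nonneg _)
    have hsub : HasSum (fun κ : {κ : ι2 d → ℤ // κ ≠ 0} => c κ.1 *
        (inner ℂ (φ.toLp 2 volume) (tLp (dualV L κ.1) u) : ℂ)) _ :=
      (Summable.of_norm_bounded (hs1.mul_right (‖φ.toLp 2 volume‖ * ‖u.toLp 2 volume‖))
        (fun κ => hb κ.1)).hasSum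
    have huniq := (hJ u φ).unique (hasSum_split (fun κ => c κ *
        (inner ℂ (φ.toLp 2 volume) (tLp (dualV L κ) u) : ℂ)) _ hsub)
    simp only [hd0, tLp_zero] at huniq
    have hRe : (inner ℂ (φ.toLp 2 volume) (R (u.toLp 2 volume)) : ℂ)
        = ∑' κ : {κ : ι2 d → ℤ // κ ≠ 0}, c κ.1 *
        (inner ℂ (φ.toLp 2 volume) (tLp (dualV L κ.1) u) : ℂ) := by
      have : R (u.toLp 2 volume) = ((|L.det| : ℝ) : ℂ) • S (u.toLp 2 volume)
          - c 0 • (u.toLp 2 volume) := rfl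
      rw [this, inner_sub_right, inner_smul_right, inner_smul_right, huniq]
      ring
    rw [hRe]
    refine (tsum_of_norm_bounded
      (hs1.mul_right (‖φ.toLp 2 volume‖ * ‖u.toLp 2 volume‖)).hasSum (fun κ => hb κ.1)).trans ?_
    rw [tsum_mul_right]
    exact mul_le_mul_of_nonneg_right hs1le (by positivity)
  have hdense : DenseRange fun u : SchwartzMap (Euc d) ℂ => u.toLp 2 (volume : Measure (Euc d)) :=
    SchwartzMap.denseRange_toLpCLM (F := ℂ) (E := Euc d) (μ := volume) (p := 2) ENNReal.ofNat_ne_top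
  have hRall : ∀ u φ : Lp ℂ 2 (volume : Measure (Euc d)),
      ‖(inner ℂ φ (R u) : ℂ)‖ ≤ σ * (‖φ‖ * ‖u‖) := by
    intro u φ
    refine hdense.induction_on₂ (p := fun u φ => ‖(inner ℂ φ (R u) : ℂ)‖ ≤ σ * (‖φ‖ * ‖u‖))
      ?_ hRS u φ
    exact isClosed_le (by fun_prop) (by fun_prop)
  have hσ0 : 0 ≤ σ := tsum_nonneg fun κ => (norm_nonneg _).trans (hle κ.1)
  have hRn : ‖R‖ ≤ σ := by
    refine R.opNorm_le_bound hσ0 fun u => ?_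
    have h := hRall u (R u)
    rw [inner_self_eq_norm_sq_to_K] at h
    have h' : ‖R u‖ * ‖R u‖ ≤ ‖R u‖ * (σ * ‖u‖) := by
      simp only [norm_pow, RCLike.norm_ofReal, abs_norm] at h
      nlinarith
    rcases (norm_nonneg (R u)).eq_or_lt with h0 | h0
    · rw [← h0]; positivity
    · exact le_of_mul_le_mul_left h' h0
  obtain ⟨T, h1, h2, h3⟩ := invert S R (c 0) |L.det| σ (abs_pos.2 hL.ne_zero) hlt hRn (by
    rw [hR]; abel)
  refine ⟨T, h1, h2, ?_⟩
  rw [htot, show 2 * ‖c 0‖ - (‖c 0‖ + σ) = ‖c 0‖ - σ by ring]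
  exact h3
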